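/- VC dimension of multiple index classes (Proposition 2, Section 5). Fix reals v_− < v_+, d,l∈ℕ*, r∈ℕ and t=(t_1,...,t_l)∈(ℕ*)^l. Let C_d = {(c_1,...,c_d)∈ℝ^d : Σ_{j=1}^d |c_j| ≤ 1} be the ℓ¹ unit ball, and let Γ̄^M_{(t,r)} be the class of functions on [0,1]^d of the form w ↦ f(g_1(w),...,g_l(w)), where g_j(w) = (⟨a_j,w⟩+1)/2 with a_j ∈ C_d for j=1,...,l, and f = (f̃ ∨ v_−) ∧ v_+ with f̃ a piecewise polynomial on the regular partition M^{H,l}_t of [0,1]^l of degree at most r in each of the l variables on each hyperrectangle (real coefficients). Then Γ̄^M_{(t,r)} is a VC-subgraph class on [0,1]^d with dimension V^M_{(t,r)} ≤ 2 + [2ld + (∏_{j=1}^l t_j)(r+1)^l]·log₂[4eU·log₂(2eU)], where U = Σ_{j=1}^l t_j + lr + l + 1. -/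

import Mathlib

/-- The unit cube `[0,1]^d`. -/
def unitCube (d : ℕ) : Set (Fin d → ℝ) := {w | ∀ j, w j ∈ Set.Icc (0:ℝ) 1}

/-- A class `F` of real-valued functions on `W` is VC-subgraph on the domain `D ⊆ W` with
dimension not larger than `V`: no finite set of points of `D × ℝ` of cardinality exceeding
`V` is shattered by the open subgraphs `{(w,t) : t < f(w)}`, `f ∈ F`. -/
def VCSubgraphLEOn {W : Type*} (D : Set W) (F : Set (W → ℝ)) (V : ℝ) : Prop :=
  ∀ S : Finset (W × ℝ), (∀ q ∈ S, q.1 ∈ D) → (S.card : ℝ) > V →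
    ∃ S' ⊆ S, ∀ f ∈ F, (↑S' : Set (W × ℝ)) ≠ (↑S : Set (W × ℝ)) ∩ {q : W × ℝ | q.2 < f q.1}

/-- The cell of the regular partition of `[0,1]` into `t` intervals. -/
def regularCell (t h : ℕ) : Set ℝ :=
  if h = 0 then Set.Icc 0 (1 / (t:ℝ))
  else Set.Ioc ((h:ℝ) / (t:ℝ)) (((h:ℝ) + 1) / (t:ℝ))

/-- Piecewise polynomials on the regular partition `M^{H,l}_t` of `[0,1]^l`, of degree at
most `r` in each of the `l` variables on each hyperrectangle (real coefficients). -/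
def pwPolyRegular (l r : ℕ) (t : Fin l → ℕ) : Set ((Fin l → ℝ) → ℝ) :=
  {f | ∀ h : Fin l → ℕ, (∀ j, h j < t j) →
      ∃ c : (Fin l → Fin (r + 1)) → ℝ,
        ∀ x : Fin l → ℝ, (∀ j, x j ∈ regularCell (t j) (h j)) →
          f x = ∑ e : Fin l → Fin (r + 1), c e * ∏ j, (x j) ^ ((e j : ℕ))}

/-- The multiple index class `Γ̄^M_{(t,r)}`: functions `w ↦ f(g_1(w),…,g_l(w))` on
`[0,1]^d`, where `g_j(w) = (⟨a_j,w⟩+1)/2` with `a_j` in the `ℓ¹` unit ball `C_d`, and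
`f = (f̃ ∨ v₋) ∧ v₊` with `f̃` a piecewise polynomial of degree at most `r` in each
variable on the regular partition `M^{H,l}_t` of `[0,1]^l`. -/
def multipleIndexClass (d l r : ℕ) (t : Fin l → ℕ) (vm vp : ℝ) :
    Set ((Fin d → ℝ) → ℝ) :=
  {γ | ∃ a : Fin l → Fin d → ℝ, (∀ j, (∑ i, |a j i|) ≤ 1) ∧
      ∃ ft ∈ pwPolyRegular l r t,
        γ = fun w => min (max (ft (fun j => ((∑ i, a j i * w i) + 1) / 2)) vm) vp}

section

open MvPolynomial Filter Topology

/-- The exponent vectors of total degree at most `T` in the variables `ι`. -/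
def degreeSimplex (ι : Type*) (T : ℕ) : Set (ι →₀ ℕ) := {α | (α.sum fun _ e => e) ≤ T}

theorem mem_degreeSimplex {ι : Type*} [Fintype ι] {T : ℕ} {α : ι →₀ ℕ} :
    α ∈ degreeSimplex ι T ↔ ∑ i, α i ≤ T := by
  change (α.sum fun _ e => e) ≤ T ↔ _
  rw [Finsupp.sum_fintype _ _ fun _ => rfl]

theorem lt_of_mem_degreeSimplex {ι : Type*} [Fintype ι] {T : ℕ} (α : degreeSimplex ι T) (i : ι) :
    α.1 i < T + 1 :=
  Nat.lt_succ_of_le <| (Finset.single_le_sum (f := fun i => α.1 i) (fun _ _ => Nat.zero_le _)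
    (Finset.mem_univ i)).trans (mem_degreeSimplex.1 α.2)

/-- An exponent vector of total degree at most `T`, as a point of a box. -/
def degreeSimplexToBox (ι : Type*) [Fintype ι] (T : ℕ) (α : degreeSimplex ι T) :
    ι → Fin (T + 1) :=
  fun i => ⟨α.1 i, lt_of_mem_degreeSimplex α i⟩

theorem degreeSimplexToBox_injective (ι : Type*) [Fintype ι] (T : ℕ) :
    Function.Injective (degreeSimplexToBox ι T) := by
  intro α β hαβ
  ext i
  simpa [degreeSimplexToBox] using congrFun hαβ i

instance finite_degreeSimplex (ι : Type*) [Fintype ι] (T : ℕ) : Finite (degreeSimplex ι T) :=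
  Finite.of_injective _ (degreeSimplexToBox_injective ι T)

/-- The number of exponent vectors of total degree at most `T` in the variables `ι`. -/
noncomputable def simplexCard (ι : Type*) (T : ℕ) : ℕ := Nat.card (degreeSimplex ι T)

theorem simplexCard_le_pow (ι : Type*) [Fintype ι] (T : ℕ) :
    simplexCard ι T ≤ (T + 1) ^ Fintype.card ι := by
  classical
  have h := Nat.card_le_card_of_injective _ (degreeSimplexToBox_injective ι T)
  rwa [Nat.card_eq_fintype_card (α := ι → Fin (T + 1)), Fintype.card_fun, Fintype.card_fin] at h

theorem simplexCard_pos (ι : Type*) [Fintype ι] (T : ℕ) : 0 < simplexCard ι T := by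
  have : Nonempty (degreeSimplex ι T) := ⟨0, mem_degreeSimplex.2 (by simp)⟩
  exact Nat.card_pos

theorem simplexCard_mul_add_le (ι : Type*) [Fintype ι] {D : ℕ} (hD : 0 < D) (T E : ℕ) :
    simplexCard ι (D * T + E) ≤ D ^ Fintype.card ι * simplexCard ι (T + E) := by
  classical
  have key : ∀ α : degreeSimplex ι (D * T + E),
      (Finsupp.equivFunOnFinite.symm fun i => α.1 i / D) ∈ degreeSimplex ι (T + E) := by
    rintro ⟨α, hα⟩
    rw [mem_degreeSimplex] at hα ⊢
    simp only [Finsupp.equivFunOnFinite_symm_apply_apply]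
    have h1 : D * ∑ i, α i / D ≤ D * T + E := by
      rw [Finset.mul_sum]
      exact (Finset.sum_le_sum fun i _ => Nat.mul_div_le _ _).trans hα
    have h2 : D * ∑ i, α i / D ≤ D * (T + E) := by nlinarith
    exact Nat.le_of_mul_le_mul_left h2 hD
  have h2 := Nat.card_le_card_of_injective (β := (ι → Fin D) × degreeSimplex ι (T + E))
    (fun α : degreeSimplex ι (D * T + E) =>
      (fun i => ⟨α.1 i % D, Nat.mod_lt _ hD⟩, ⟨_, key α⟩)) (by
      intro α β hαβ
      simp only [Prod.mk.injEq, Subtype.mk.injEq, EmbeddingLike.apply_eq_iff_eq] at hαβ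
      ext i
      have h1 := congrFun hαβ.1 i
      have h2 := congrFun hαβ.2 i
      simp only [Fin.mk.injEq] at h1 h2
      rw [← Nat.div_add_mod (α.1 i) D, ← Nat.div_add_mod (β.1 i) D, h1, h2])
  rwa [Nat.card_prod, Nat.card_eq_fintype_card (α := ι → Fin D), Fintype.card_fun,
    Fintype.card_fin] at h2

theorem finrank_restrictTotalDegree (ι : Type*) [Fintype ι] (T : ℕ) :
    Module.finrank ℝ (restrictTotalDegree ι ℝ T) = simplexCard ι T :=
  Module.finrank_eq_nat_card_basis (basisRestrictSupport ℝ _)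

/-- Polynomial growth of `simplexCard` turns an asymptotic comparison into a bound. -/
theorem le_pow_of_forall_mul_simplexCard_le (ι : Type*) [Fintype ι] {D N k : ℕ} (hD : 0 < D)
    (h : ∀ T, N * simplexCard ι T ≤ simplexCard ι (D * T + k)) : N ≤ D ^ Fintype.card ι := by
  by_contra! hN
  set b := D ^ Fintype.card ι with hb
  have hb0 : 0 < b := by positivity
  have hstep : ∀ T, (b + 1) * simplexCard ι T ≤ b * simplexCard ι (T + k) := fun T =>
    ((Nat.mul_le_mul_right _ hN).trans (h T)).trans (simplexCard_mul_add_le ι hD T k)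
  have hiter : ∀ j : ℕ, (b + 1) ^ j ≤ b ^ j * simplexCard ι (j * k) := by
    intro j
    induction j with
    | zero => simpa using Nat.succ_le_of_lt (simplexCard_pos ι 0)
    | succ j ih =>
      calc (b + 1) ^ (j + 1) = (b + 1) ^ j * (b + 1) := pow_succ _ _
        _ ≤ b ^ j * simplexCard ι (j * k) * (b + 1) := Nat.mul_le_mul_right _ ih
        _ = b ^ j * ((b + 1) * simplexCard ι (j * k)) := by ring
        _ ≤ b ^ j * (b * simplexCard ι (j * k + k)) := Nat.mul_le_mul_left _ (hstep _)
        _ = b ^ (j + 1) * simplexCard ι ((j + 1) * k) := by rw [Nat.succ_mul]; ring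
  set n := Fintype.card ι
  set r : ℝ := (b + 1) / b with hr
  have hbR : (0 : ℝ) < b := by exact_mod_cast hb0
  have hr1 : 1 < r := by rw [hr, one_lt_div hbR]; linarith
  have hlim := tendsto_pow_const_div_const_pow_of_one_lt n hr1
  have hpos : (0 : ℝ) < 1 / (k + 1) ^ n / 2 := by positivity
  obtain ⟨j, hj, hj1⟩ := ((hlim.eventually (gt_mem_nhds hpos)).and (eventually_ge_atTop 1)).exists
  have h1 : r ^ j ≤ ((k + 1) * j : ℝ) ^ n := by
    rw [hr, div_pow, div_le_iff₀ (by positivity)]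
    calc ((b : ℝ) + 1) ^ j ≤ b ^ j * simplexCard ι (j * k) := by exact_mod_cast hiter j
      _ ≤ b ^ j * ((j * k + 1 : ℕ) : ℝ) ^ n := by
        gcongr; exact_mod_cast simplexCard_le_pow ι (j * k)
      _ ≤ b ^ j * ((k + 1) * j : ℝ) ^ n := by
        gcongr
        have : (1 : ℝ) ≤ j := by exact_mod_cast hj1
        push_cast; nlinarith
      _ = _ := by ring
  have hrj : 0 < r ^ j := by positivity
  rw [div_lt_iff₀ hrj, mul_pow] at *
  have hk : (0 : ℝ) < (k + 1) ^ n := by positivity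
  have : (k + 1 : ℝ) ^ n * (j : ℝ) ^ n < r ^ j / 2 := by
    have := mul_lt_mul_of_pos_left hj hk
    have e : (k + 1 : ℝ) ^ n * (1 / (k + 1) ^ n / 2 * r ^ j) = r ^ j / 2 := by field_simp
    linarith
  linarith

/-- The polynomial map attached to a tuple of polynomials. -/
noncomputable def evalMap {ι κ : Type*} (F : κ → MvPolynomial ι ℝ) (x : ι → ℝ) : κ → ℝ :=
  fun j => eval x (F j)

theorem contDiff_eval {ι : Type*} [Fintype ι] (p : MvPolynomial ι ℝ) {n : WithTop ℕ∞} :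
    ContDiff ℝ n fun x : ι → ℝ => eval x p :=
  (AnalyticOnNhd.eval_mvPolynomial p).contDiff

theorem contDiff_evalMap {ι κ : Type*} [Fintype ι] [Fintype κ] (F : κ → MvPolynomial ι ℝ)
    {n : WithTop ℕ∞} : ContDiff ℝ n (evalMap F) :=
  contDiff_pi.2 fun j => contDiff_eval (F j)

/-- A finite set of points is separated by the values of some polynomial. -/
theorem exists_polynomial_injOn {ι : Type*} [Fintype ι] (Z : Finset (ι → ℝ)) :
    ∃ g : MvPolynomial ι ℝ, Set.InjOn (fun x => eval x g) Z := by
  classical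
  let v : {q : Z × Z // q.1 ≠ q.2} → ι → ℝ := fun q => q.1.1.1 - q.1.2.1
  have hv : ∀ q, v q ≠ 0 := fun q h => q.2 (Subtype.ext (sub_eq_zero.1 h))
  obtain ⟨φ, hφ⟩ := Module.exists_dual_forall_apply_ne_zero (K := ℝ) v hv
  refine ⟨∑ i, C (φ (Pi.single i 1)) * X i, fun x hx y hy hxy => ?_⟩
  by_contra hne
  apply hφ ⟨(⟨x, hx⟩, ⟨y, hy⟩), fun h => hne (congrArg Subtype.val h)⟩
  have e : ∀ z : ι → ℝ, eval z (∑ i, C (φ (Pi.single i 1)) * X i) = φ z := by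
    intro z
    conv_rhs => rw [pi_eq_sum_univ' z]
    simp [mul_comm]
  simp only [e] at hxy
  simp [v, hxy]

theorem eq_zero_of_eventually_eval_eq_zero {ι : Type*} [Finite ι] {p : MvPolynomial ι ℝ}
    {a : ι → ℝ} (h : ∀ᶠ x in 𝓝 a, eval x p = 0) : p = 0 := by
  have := Fintype.ofFinite ι
  obtain ⟨ε, hε, hb⟩ := Metric.eventually_nhds_iff_ball.1 h
  refine funext_set (fun i => Metric.ball (a i) ε) (fun i => ?_) fun x hx => ?_
  · rw [Real.ball_eq_Ioo]
    exact Set.Ioo_infinite (by linarith)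
  · rw [map_zero]
    apply hb
    rw [ball_pi _ hε]
    exact hx

/-- The products `∏ F_i ^ α_i * g ^ j` with `j` less than the number of points of `Z` are linearly
independent, if `g` separates the set `Z` of nondegenerate common zeros of `F`. -/
theorem linearIndependent_pow_mul_pow {ι : Type*} [Fintype ι] (F : ι → MvPolynomial ι ℝ)
    (Z : Finset (ι → ℝ)) (hZ : ∀ z ∈ Z, evalMap F z = 0)
    (hdet : ∀ z ∈ Z, (fderiv ℝ (evalMap F) z).det ≠ 0) (g : MvPolynomial ι ℝ)
    (hg : Set.InjOn (fun x => eval x g) Z) (s : Set (ι →₀ ℕ)) [Finite s] :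
    LinearIndependent ℝ fun q : s × Fin Z.card => (∏ i, F i ^ q.1.1 i) * g ^ (q.2 : ℕ) := by
  classical
  have := Fintype.ofFinite s
  rw [Fintype.linearIndependent_iff]
  intro c hc
  -- disjoint neighbourhoods on which `g` takes distinct values
  obtain ⟨U, hU, hUd⟩ := (Z.image fun x => eval x g).finite_toSet.t2_separation
  have hsurj : ∀ᶠ y in 𝓝 (0 : ι → ℝ), ∀ z : Z,
      ∃ x, evalMap F x = y ∧ eval x g ∈ U (eval z.1 g) := by
    rw [eventually_all]
    rintro ⟨z, hz⟩
    have hstrict : HasStrictFDerivAt (evalMap F) (fderiv ℝ (evalMap F) z) z :=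
      (contDiff_evalMap F (n := 1)).contDiffAt.hasStrictFDerivAt one_ne_zero
    rw [← ContinuousLinearMap.coe_toContinuousLinearEquivOfDetNeZero _ (hdet z hz)] at hstrict
    have hmap := hstrict.map_nhds_eq_of_equiv
    rw [hZ z hz] at hmap
    rw [← hmap, eventually_map]
    have hcont : ContinuousAt (fun x => eval x g) z :=
      (contDiff_eval g (n := 0)).continuous.continuousAt
    filter_upwards [hcont.eventually ((hU (eval z g)).2.mem_nhds (hU _).1)] with x hx
    exact ⟨x, rfl, hx⟩
  let Q : Fin Z.card → MvPolynomial ι ℝ := fun j => ∑ α : s, monomial α.1 (c (α, j))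
  have hQ : ∀ j, Q j = 0 := by
    intro j
    refine eq_zero_of_eventually_eval_eq_zero (a := 0) ?_
    filter_upwards [hsurj] with y hy
    choose x hx hxU using hy
    let P : Polynomial ℝ := ∑ j : Fin Z.card, Polynomial.monomial (j : ℕ) (eval y (Q j))
    have hP : P = 0 := by
      by_contra hP0
      have hinj : Function.Injective fun z : Z => eval (x z) g := by
        intro z w hzw
        by_contra hne
        have hne' : eval z.1 g ≠ eval w.1 g := fun h => hne (Subtype.ext (hg z.2 w.2 h))
        refine Set.disjoint_left.1 (hUd (by simpa using ⟨z.1, z.2, rfl⟩)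
          (by simpa using ⟨w.1, w.2, rfl⟩) hne') (hxU z) ?_
        simp only at hzw
        rw [hzw]
        exact hxU w
      refine hP0 (Polynomial.eq_zero_of_natDegree_lt_card_of_eval_eq_zero P hinj (fun z => ?_) ?_)
      · have := congrArg (eval (x z)) hc
        simp only [map_sum, smul_eval, map_mul, map_prod, map_pow, map_zero,
          Fintype.sum_prod_type] at this
        rw [Finset.sum_comm] at this
        simp only [P, Polynomial.eval_finsetSum, Polynomial.eval_monomial, Q, map_sum,
          eval_monomial]
        rw [← this]
        refine Finset.sum_congr rfl fun j _ => Finset.sum_congr rfl fun α _ => ?_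
        rw [Finsupp.prod_fintype _ _ (by simp), mul_assoc]
        have hxz : ∀ i, eval (x z) (F i) = y i := fun i => congrFun (hx z) i
        simp only [hxz]
      · have hpos : 0 < Z.card := by
          rcases Nat.eq_zero_or_pos Z.card with h | h
          · exact absurd j.2 (by omega)
          · exact h
        rw [Fintype.card_coe]
        refine (Polynomial.natDegree_lt_iff_degree_lt hP0).2 ?_
        refine (Polynomial.degree_sum_le _ _).trans_lt ?_
        rw [Finset.sup_lt_iff (by exact_mod_cast WithBot.bot_lt_coe Z.card)]
        intro j _
        exact (Polynomial.degree_monomial_le _ _).trans_lt (by exact_mod_cast j.2)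
    have := congrArg (fun P => P.coeff (j : ℕ)) hP
    simpa [P, Polynomial.finsetSum_coeff, Polynomial.coeff_monomial, Fin.val_inj] using this
  rintro ⟨α, j⟩
  have := congrArg (coeff α.1) (hQ j)
  simpa [Q, coeff_sum, coeff_monomial, Subtype.val_inj] using this

/-- A square polynomial system of degree at most `D` has at most `D ^ n` nondegenerate real
zeros. -/
theorem card_nondegenerate_zeros_le {ι : Type*} [Fintype ι] (F : ι → MvPolynomial ι ℝ) {D : ℕ}
    (hD : 0 < D) (hF : ∀ i, (F i).totalDegree ≤ D) (Z : Finset (ι → ℝ))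
    (hZ : ∀ z ∈ Z, evalMap F z = 0) (hdet : ∀ z ∈ Z, (fderiv ℝ (evalMap F) z).det ≠ 0) :
    Z.card ≤ D ^ Fintype.card ι := by
  classical
  obtain ⟨g, hg⟩ := exists_polynomial_injOn Z
  refine le_pow_of_forall_mul_simplexCard_le ι (k := Z.card * g.totalDegree) hD fun T => ?_
  have := Fintype.ofFinite (degreeSimplex ι T)
  have hmem : ∀ q : degreeSimplex ι T × Fin Z.card, (∏ i, F i ^ q.1.1 i) * g ^ (q.2 : ℕ) ∈
      restrictTotalDegree ι ℝ (D * T + Z.card * g.totalDegree) := by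
    rintro ⟨α, j⟩
    rw [mem_restrictTotalDegree]
    refine (totalDegree_mul _ _).trans (add_le_add ?_ ?_)
    · refine (totalDegree_finsetProd _ _).trans ?_
      calc ∑ i, (F i ^ α.1 i).totalDegree ≤ ∑ i, D * α.1 i := by
            refine Finset.sum_le_sum fun i _ => (totalDegree_pow _ _).trans ?_
            rw [mul_comm D]
            exact Nat.mul_le_mul_left _ (hF i)
        _ ≤ D * T := by
            rw [← Finset.mul_sum]
            exact Nat.mul_le_mul_left _ (mem_degreeSimplex.1 α.2)
    · exact (totalDegree_pow _ _).trans (Nat.mul_le_mul_right _ j.2.le)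
  have hli : LinearIndependent ℝ fun q : degreeSimplex ι T × Fin Z.card =>
      (⟨_, hmem q⟩ : restrictTotalDegree ι ℝ (D * T + Z.card * g.totalDegree)) :=
    LinearIndependent.of_comp (Submodule.subtype _)
      (linearIndependent_pow_mul_pow F Z hZ hdet g hg (degreeSimplex ι T))
  have hcard := hli.fintype_card_le_finrank
  rw [finrank_restrictTotalDegree, Fintype.card_prod, Fintype.card_fin, mul_comm] at hcard
  rwa [simplexCard, Nat.card_eq_fintype_card]

theorem hasFDerivAt_eval {ι : Type*} [Fintype ι] (p : MvPolynomial ι ℝ) (x : ι → ℝ) :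
    HasFDerivAt (fun y : ι → ℝ => eval y p)
      (∑ i, eval x (pderiv i p) • ContinuousLinearMap.proj (R := ℝ) (φ := fun _ : ι => ℝ) i) x := by
  classical
  induction p using MvPolynomial.induction_on with
  | C a => simpa using hasFDerivAt_const a x
  | add p q hp hq =>
    simp only [map_add, add_smul, Finset.sum_add_distrib]
    exact hp.add hq
  | mul_X p i hp =>
    have h := hp.mul ((ContinuousLinearMap.proj (R := ℝ) (φ := fun _ : ι => ℝ) i).hasFDerivAt
      (x := x))
    simp only [map_mul, eval_X]
    refine h.congr_fderiv ?_
    ext v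
    simp [pderiv_X, Pi.single_apply, Finset.mul_sum, Finset.sum_add_distrib, add_mul]
    simp [mul_ite, apply_ite (eval x), mul_comm, mul_left_comm]

theorem eval_pderiv_eq_zero_of_isLocalMin {ι : Type*} [Fintype ι] {p : MvPolynomial ι ℝ}
    {x : ι → ℝ} (h : IsLocalMin (fun y : ι → ℝ => eval y p) x) (i : ι) :
    eval x (pderiv i p) = 0 := by
  classical
  have := congrArg (fun L : (ι → ℝ) →L[ℝ] ℝ => L (Pi.single i 1))
    (h.hasFDerivAt_eq_zero (hasFDerivAt_eval p x))
  simpa [Pi.single_apply] using this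

/-- Outside a small set of levels, no point lies on more than `n` level sets, and the level
sets are null. -/
theorem dense_generic_levels {ι κ : Type*} [Fintype ι] [Fintype κ] [DecidableEq κ]
    (p : κ → MvPolynomial ι ℝ) :
    Dense {e : κ → ℝ | (∀ T : Finset κ, T.card = Fintype.card ι + 1 →
      ∀ x, ∃ i ∈ T, eval x (p i) ≠ e i) ∧
      ∀ i, MeasureTheory.volume {x : ι → ℝ | eval x (p i) = e i} = 0} := by
  classical
  set n := Fintype.card ι
  have hcount : ∀ i, {c : ℝ | 0 < MeasureTheory.volume {x : ι → ℝ | eval x (p i) = c}}.Countable :=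
    fun i => MeasureTheory.Measure.countable_meas_level_set_pos
      ((contDiff_eval (p i) (n := 0)).continuous.measurable)
  let I₁ := {T : Finset κ // T.card = n + 1}
  let I₂ := Σ i : κ, {c : ℝ | 0 < MeasureTheory.volume {x : ι → ℝ | eval x (p i) = c}}
  have : ∀ i, Countable {c : ℝ | 0 < MeasureTheory.volume {x : ι → ℝ | eval x (p i) = c}} :=
    fun i => (hcount i).to_subtype
  let f₁ : (T : I₁) → ((ι → ℝ) × ({i // i ∉ T.1} → ℝ)) → κ → ℝ := fun T y i =>
    if h : i ∉ T.1 then y.2 ⟨i, h⟩ else eval y.1 (p i)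
  let f₂ : (q : I₂) → ({i // i ≠ q.1} → ℝ) → κ → ℝ := fun q y i =>
    if h : i ≠ q.1 then y ⟨i, h⟩ else q.2.1
  have h₁ : ∀ T, dimH (Set.range (f₁ T)) ≤ (Fintype.card κ - 1 : ℕ) := by
    intro T
    have hf : ContDiff ℝ 1 (f₁ T) := by
      refine contDiff_pi.2 fun i => ?_
      by_cases h : i ∉ T.1
      · simp only [f₁, dif_pos h]
        fun_prop
      · simp only [f₁, dif_neg h]
        exact (contDiff_eval (p i)).comp contDiff_fst
    refine hf.dimH_range_le.trans ?_
    have h2 : T.1.card ≤ Fintype.card κ := Finset.card_le_univ _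
    have h3 := T.2
    have h4 : Fintype.card {i // i ∉ T.1} = Fintype.card κ - T.1.card := by
      simp
    norm_cast
    rw [Module.finrank_prod, Module.finrank_fintype_fun_eq_card,
      Module.finrank_fintype_fun_eq_card, h4]
    omega
  have h₂ : ∀ q, dimH (Set.range (f₂ q)) ≤ (Fintype.card κ - 1 : ℕ) := by
    intro q
    have hf : ContDiff ℝ 1 (f₂ q) := by
      refine contDiff_pi.2 fun i => ?_
      by_cases h : i ≠ q.1
      · simp only [f₂, dif_pos h]
        fun_prop
      · simp only [f₂, dif_neg h]
        fun_prop
    refine hf.dimH_range_le.trans ?_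
    norm_cast
    rw [Module.finrank_fintype_fun_eq_card]
    simp [Fintype.card_subtype_compl]
  rcases isEmpty_or_nonempty κ with hκ | hκ
  · convert dense_univ
    refine Set.eq_univ_of_forall fun e => ⟨fun T hT => ?_, fun i => hκ.elim i⟩
    rw [Finset.eq_empty_of_isEmpty T] at hT
    simp at hT
  have hdim : dimH ((⋃ T, Set.range (f₁ T)) ∪ ⋃ q, Set.range (f₂ q)) <
      Module.finrank ℝ (κ → ℝ) := by
    rw [dimH_union, dimH_iUnion, dimH_iUnion, Module.finrank_fintype_fun_eq_card]
    refine (max_le (iSup_le h₁) (iSup_le h₂)).trans_lt ?_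
    have := Fintype.card_pos (α := κ)
    exact_mod_cast (by omega : Fintype.card κ - 1 < Fintype.card κ)
  refine (dense_compl_of_dimH_lt_finrank hdim).mono fun e he => ?_
  simp only [Set.mem_compl_iff, Set.mem_union, Set.mem_iUnion, Set.mem_range, not_or,
    not_exists] at he
  refine ⟨fun T hT x => ?_, fun i => ?_⟩
  · by_contra! hx
    refine he.1 ⟨T, hT⟩ (x, fun i => e i) ?_
    funext i
    by_cases h : i ∈ T
    · simp [f₁, h, hx i h]
    · simp [f₁, h]
  · by_contra hi
    refine he.2 ⟨i, e i, pos_iff_ne_zero.2 hi⟩ (fun i => e i) ?_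
    funext j
    by_cases h : j = i
    · subst h; simp [f₂]
    · simp [f₂, h]

/-- On a compact set, generic levels remain generic after a small perturbation. -/
theorem exists_margin {ι κ : Type*} [Fintype ι] [Fintype κ]
    (p : κ → MvPolynomial ι ℝ) (e : κ → ℝ) (n : ℕ)
    (he : ∀ T : Finset κ, T.card = n + 1 → ∀ x, ∃ i ∈ T, eval x (p i) ≠ e i)
    {B : Set (ι → ℝ)} (hB : IsCompact B) :
    ∃ η > 0, ∀ x ∈ B, ∀ T : Finset κ, (∀ i ∈ T, |eval x (p i) - e i| ≤ η) → T.card ≤ n := by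
  classical
  have hT : ∀ T : Finset κ, T.card = n + 1 → ∃ δ > 0, ∀ x ∈ B,
      δ ≤ ∑ i ∈ T, |eval x (p i) - e i| := by
    intro T hT
    have hc : Continuous fun x : ι → ℝ => ∑ i ∈ T, |eval x (p i) - e i| :=
      continuous_finsetSum _ fun i _ =>
        (((contDiff_eval (p i) (n := 0)).continuous.sub continuous_const)).abs
    rcases B.eq_empty_or_nonempty with rfl | hne
    · exact ⟨1, one_pos, by simp⟩
    obtain ⟨x, hx, hmin⟩ := hB.exists_isMinOn hne hc.continuousOn
    refine ⟨_, ?_, fun y hy => hmin hy⟩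
    obtain ⟨i, hi, hne⟩ := he T hT x
    exact Finset.sum_pos' (fun _ _ => abs_nonneg _) ⟨i, hi, abs_pos.2 (sub_ne_zero.2 hne)⟩
  have hev : ∀ᶠ η in 𝓝[>] (0 : ℝ), ∀ T : Finset κ, T.card = n + 1 → ∀ x ∈ B,
      (n + 1) * η < ∑ i ∈ T, |eval x (p i) - e i| := by
    rw [eventually_all]
    intro T
    by_cases h : T.card = n + 1
    · obtain ⟨δ, hδ, hδB⟩ := hT T h
      have : ∀ᶠ η in 𝓝[>] (0 : ℝ), η < δ / (n + 1) :=
        mem_nhdsWithin_of_mem_nhds (gt_mem_nhds (by positivity))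
      filter_upwards [this] with η hη _ x hx
      rw [lt_div_iff₀ (by positivity)] at hη
      linarith [hδB x hx]
    · simp [h]
  obtain ⟨η, hη, hη0⟩ := (hev.and self_mem_nhdsWithin).exists
  refine ⟨η, hη0, fun x hx T hTx => ?_⟩
  by_contra! hlt
  obtain ⟨T', hT'T, hT'⟩ := Finset.exists_subset_card_eq hlt
  have h1 := hη T' hT' x hx
  have h2 : ∑ i ∈ T', |eval x (p i) - e i| ≤ T'.card • η :=
    Finset.sum_le_card_nsmul _ _ _ fun i hi => hTx i (hT'T hi)
  rw [hT', nsmul_eq_mul] at h2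
  push_cast at h2
  linarith

theorem totalDegree_pderiv_le {ι : Type*} {p : MvPolynomial ι ℝ} {D : ℕ}
    (hp : p.totalDegree ≤ D) (j : ι) : (pderiv j p).totalDegree ≤ D - 1 := by
  classical
  rw [p.as_sum, map_sum]
  refine totalDegree_finsetSum_le fun α hα => ?_
  rw [pderiv_monomial]
  by_cases h0 : α j = 0
  · simp [h0]
  have h1 : (α.sum fun _ e => e) ≤ D := (le_totalDegree hα).trans hp
  refine (totalDegree_monomial_le _ _).trans ?_
  have h2 : α - Finsupp.single j 1 + Finsupp.single j 1 = α :=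
    tsub_add_cancel_of_le (Finsupp.single_le_iff.2 (Nat.one_le_iff_ne_zero.2 h0))
  have h3 : ((α - Finsupp.single j 1 + Finsupp.single j 1).sum fun _ e => e) =
      α.sum fun _ e => e := by rw [h2]
  rw [Finsupp.sum_add_index' (fun _ => rfl) (fun _ _ _ => rfl),
    Finsupp.sum_single_index rfl] at h3
  change ((α - Finsupp.single j 1).sum fun _ e => e) ≤ D - 1
  omega

/-- Half the gradient, up to a constant, of the penalized squared distance
`∑ (x_j - b_j)² + K ∑_{i ∈ S} (p_i - e_i)²`. -/
noncomputable def penaltyGrad {ι κ : Type*} (p : κ → MvPolynomial ι ℝ) (e : κ → ℝ) (K : ℝ)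
    (S : Finset κ) (j : ι) : MvPolynomial ι ℝ :=
  X j + C K * ∑ i ∈ S, (p i - C (e i)) * pderiv j (p i)

theorem totalDegree_penaltyGrad_le {ι κ : Type*} {p : κ → MvPolynomial ι ℝ} {D : ℕ} (hD : 0 < D)
    (hp : ∀ i, (p i).totalDegree ≤ D) (e : κ → ℝ) (K : ℝ) (S : Finset κ) (j : ι) :
    (penaltyGrad p e K S j).totalDegree ≤ 2 * D - 1 := by
  refine (totalDegree_add _ _).trans (max_le ?_ ?_)
  · rw [totalDegree_X]; omega
  refine (totalDegree_mul _ _).trans ?_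
  rw [totalDegree_C, zero_add]
  refine totalDegree_finsetSum_le fun i _ => (totalDegree_mul _ _).trans ?_
  have h1 : (p i - C (e i)).totalDegree ≤ D :=
    (totalDegree_sub _ _).trans (max_le (hp i) (by simp))
  have h2 := totalDegree_pderiv_le (hp i) j
  omega

theorem evalMap_penaltyGrad_eq_of_isLocalMin {ι κ : Type*} [Fintype ι]
    (p : κ → MvPolynomial ι ℝ) (e : κ → ℝ) (K : ℝ) (S : Finset κ) (b x : ι → ℝ)
    (h : IsLocalMin (fun y : ι → ℝ =>
      ∑ j, (y j - b j) ^ 2 + K * ∑ i ∈ S, (eval y (p i) - e i) ^ 2) x) :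
    evalMap (penaltyGrad p e K S) x = b := by
  classical
  let Q : MvPolynomial ι ℝ :=
    ∑ j, (X j - C (b j)) ^ 2 + C K * ∑ i ∈ S, (p i - C (e i)) ^ 2
  have hQ : IsLocalMin (fun y : ι → ℝ => eval y Q) x := by
    simpa [Q] using h
  funext j
  have h0 := eval_pderiv_eq_zero_of_isLocalMin hQ j
  have h1 : eval x (pderiv j Q) = 2 * (eval x (penaltyGrad p e K S j) - b j) := by
    simp only [Q, penaltyGrad, map_add, map_sum, map_mul, map_sub, pderiv_C_mul, pderiv_pow,
      pderiv_X, pderiv_C, eval_X, eval_C, map_pow, sub_zero, Pi.single_apply]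
    simp only [apply_ite (eval x), map_one, map_zero, mul_ite, mul_one, mul_zero, map_natCast]
    simp only [Nat.cast_ofNat, Nat.reduceSub, pow_one, mul_assoc, ← Finset.mul_sum,
      Finset.sum_ite_eq',
      Finset.mem_univ, if_true]
    ring
  unfold evalMap
  linarith

/-- For almost every base point, the penalized squared distances are all Morse and have no
critical points on the level sets. -/
theorem ae_generic_base {ι κ : Type*} [Fintype ι] [Fintype κ]
    (p : κ → MvPolynomial ι ℝ) (e : κ → ℝ) (K : ℝ)
    (he : ∀ i, MeasureTheory.volume {x : ι → ℝ | eval x (p i) = e i} = 0) :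
    ∀ᵐ b : ι → ℝ, ∀ S : Finset κ, ∀ x, evalMap (penaltyGrad p e K S) x = b →
      (fderiv ℝ (evalMap (penaltyGrad p e K S)) x).det ≠ 0 ∧ ∀ i, eval x (p i) ≠ e i := by
  rw [MeasureTheory.ae_all_iff]
  intro S
  have hd : Differentiable ℝ (evalMap (penaltyGrad p e K S)) :=
    (contDiff_evalMap (penaltyGrad p e K S) (n := 1)).differentiable one_ne_zero
  have h1 := MeasureTheory.addHaar_image_eq_zero_of_det_fderivWithin_eq_zero MeasureTheory.volume
    (f := evalMap (penaltyGrad p e K S))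
    (f' := fderiv ℝ (evalMap (penaltyGrad p e K S)))
    (s := {x | (fderiv ℝ (evalMap (penaltyGrad p e K S)) x).det = 0})
    (fun x _ => (hd x).hasFDerivAt.hasFDerivWithinAt) (fun x hx => hx)
  have h2 : ∀ i, MeasureTheory.volume
      (evalMap (penaltyGrad p e K S) '' {x : ι → ℝ | eval x (p i) = e i}) = 0 := fun i =>
    MeasureTheory.addHaar_image_eq_zero_of_differentiableOn_of_addHaar_eq_zero _
      hd.differentiableOn (he i)
  have h2' := MeasureTheory.measure_iUnion_null h2
  filter_upwards [MeasureTheory.measure_eq_zero_iff_ae_notMem.1 h1,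
    MeasureTheory.measure_eq_zero_iff_ae_notMem.1 h2'] with b hb1 hb2 x hx
  refine ⟨fun h => hb1 ⟨x, h, hx⟩, fun i hi => hb2 (Set.mem_iUnion.2 ⟨i, x, hi, hx⟩)⟩

/-- The constraints of a sign pattern `A` that are violated or tight at `x`. -/
noncomputable def looseSet {ι κ : Type*} [Fintype κ] (p : κ → MvPolynomial ι ℝ) (e : κ → ℝ)
    (A : Finset κ) (x : ι → ℝ) : Finset κ := by
  classical
  exact Finset.univ.filter fun i => if i ∈ A then eval x (p i) ≤ e i else e i ≤ eval x (p i)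

/-- The amount by which `x` violates the `i`-th constraint of a sign pattern `A`. -/
noncomputable def violation {ι κ : Type*} (p : κ → MvPolynomial ι ℝ) (e : κ → ℝ)
    (A : Finset κ) (x : ι → ℝ) (i : κ) : ℝ := by
  classical
  exact if i ∈ A then max 0 (e i - eval x (p i)) else max 0 (eval x (p i) - e i)

theorem continuous_violation {ι κ : Type*} [Fintype ι] (p : κ → MvPolynomial ι ℝ) (e : κ → ℝ)
    (A : Finset κ) (i : κ) : Continuous fun x => violation p e A x i := by
  have h := (contDiff_eval (p i) (n := 0)).continuous
  unfold violation
  split_ifs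
  · exact continuous_const.max (continuous_const.sub h)
  · exact continuous_const.max (h.sub continuous_const)

theorem violation_sq_le {ι κ : Type*} (p : κ → MvPolynomial ι ℝ) (e : κ → ℝ)
    (A : Finset κ) (x : ι → ℝ) (i : κ) : violation p e A x i ^ 2 ≤ (eval x (p i) - e i) ^ 2 := by
  unfold violation
  split_ifs
  · rcases le_total 0 (e i - eval x (p i)) with h | h
    · rw [max_eq_right h]; exact le_of_eq (by ring)
    · rw [max_eq_left h]; simpa using sq_nonneg (eval x (p i) - e i)
  · rcases le_total 0 (eval x (p i) - e i) with h | h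
    · rw [max_eq_right h]
    · rw [max_eq_left h]; simpa using sq_nonneg (eval x (p i) - e i)

theorem violation_sq_eq {ι κ : Type*} [Fintype κ] {p : κ → MvPolynomial ι ℝ} {e : κ → ℝ}
    {A : Finset κ} {x : ι → ℝ} {i : κ} (h : i ∈ looseSet p e A x) :
    violation p e A x i ^ 2 = (eval x (p i) - e i) ^ 2 := by
  simp only [looseSet, Finset.mem_filter, Finset.mem_univ, true_and] at h
  unfold violation
  split_ifs at h ⊢
  · rw [max_eq_right (sub_nonneg.2 h)]; ring
  · rw [max_eq_right (sub_nonneg.2 h)]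

theorem violation_eq_zero {ι κ : Type*} [Fintype κ] {p : κ → MvPolynomial ι ℝ} {e : κ → ℝ}
    {A : Finset κ} {x : ι → ℝ} {i : κ} (h : i ∉ looseSet p e A x) : violation p e A x i = 0 := by
  simp only [looseSet, Finset.mem_filter, Finset.mem_univ, true_and] at h
  unfold violation
  split_ifs at h ⊢
  · exact max_eq_left (by linarith)
  · exact max_eq_left (by linarith)

/-- Near `x`, the constraints that hold strictly at `x` still hold strictly. -/
theorem eventually_looseSet_subset {ι κ : Type*} [Fintype ι] [Fintype κ]
    (p : κ → MvPolynomial ι ℝ) (e : κ → ℝ) (A : Finset κ) (x : ι → ℝ) :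
    ∀ᶠ y in 𝓝 x, looseSet p e A y ⊆ looseSet p e A x := by
  have : ∀ᶠ y in 𝓝 x, ∀ i, i ∉ looseSet p e A x → i ∉ looseSet p e A y := by
    rw [eventually_all]
    intro i
    have hc := (contDiff_eval (p i) (n := 0)).continuous.continuousAt (x := x)
    simp only [looseSet, Finset.mem_filter, Finset.mem_univ, true_and]
    split_ifs
    · by_cases h : eval x (p i) ≤ e i
      · simp [h]
      · filter_upwards [hc.eventually (lt_mem_nhds (not_le.1 h))] with y hy _
        exact not_le.2 hy
    · by_cases h : e i ≤ eval x (p i)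
      · simp [h]
      · filter_upwards [hc.eventually (gt_mem_nhds (not_le.1 h))] with y hy _
        exact not_le.2 hy
  filter_upwards [this] with y hy i hi
  by_contra h
  exact hy i h hi

/-- A local minimizer of the penalized distance to a sign region is a critical point of the
polynomial penalty of its loose constraints. -/
theorem evalMap_penaltyGrad_looseSet_eq {ι κ : Type*} [Fintype ι] [Fintype κ]
    (p : κ → MvPolynomial ι ℝ) (e : κ → ℝ) {K : ℝ} (hK : 0 ≤ K) (A : Finset κ) (b x : ι → ℝ)
    (h : IsLocalMin (fun y : ι → ℝ =>
      ∑ j, (y j - b j) ^ 2 + K * ∑ i, violation p e A y i ^ 2) x) :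
    evalMap (penaltyGrad p e K (looseSet p e A x)) x = b := by
  refine evalMap_penaltyGrad_eq_of_isLocalMin p e K _ b x ?_
  filter_upwards [h, eventually_looseSet_subset p e A x] with y hy hsub
  have hx : ∑ i, violation p e A x i ^ 2 =
      ∑ i ∈ looseSet p e A x, (eval x (p i) - e i) ^ 2 := by
    rw [← Finset.sum_subset (Finset.subset_univ (looseSet p e A x))
      fun i _ hi => by rw [violation_eq_zero hi]; ring]
    exact Finset.sum_congr rfl fun i hi => violation_sq_eq hi
  have hle : ∑ i, violation p e A y i ^ 2 ≤
      ∑ i ∈ looseSet p e A x, (eval y (p i) - e i) ^ 2 := by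
    rw [← Finset.sum_subset (Finset.subset_univ (looseSet p e A x))
      fun i _ hi => by rw [violation_eq_zero fun h => hi (hsub h)]; ring]
    exact Finset.sum_le_sum fun i _ => violation_sq_le p e A y i
  rw [hx] at hy
  refine hy.trans ?_
  gcongr

/-- The penalized distance to a sign region has a local minimizer at which the penalty is
controlled by the distance from the base point `b` to a point `w` of the region. -/
theorem exists_isLocalMin_penalty {ι κ : Type*} [Fintype ι] [Fintype κ]
    (p : κ → MvPolynomial ι ℝ) (e : κ → ℝ) {K : ℝ} (hK : 0 ≤ K) (A : Finset κ) (b w : ι → ℝ)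
    {M : ℝ} (hb : ∀ j, |b j| ≤ 1) (hw : ∀ i, violation p e A w i = 0)
    (hM : ∑ j, (|w j| + 1) ^ 2 ≤ M) :
    ∃ x ∈ Metric.closedBall (0 : ι → ℝ) (M + 3), IsLocalMin (fun y : ι → ℝ =>
      ∑ j, (y j - b j) ^ 2 + K * ∑ i, violation p e A y i ^ 2) x ∧
      ∀ i, K * violation p e A x i ^ 2 ≤ M := by
  set H : (ι → ℝ) → ℝ := fun y => ∑ j, (y j - b j) ^ 2 + K * ∑ i, violation p e A y i ^ 2 with hH
  have hM0 : 0 ≤ M := (Finset.sum_nonneg fun _ _ => sq_nonneg _).trans hM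
  have hcont : Continuous H := by
    have := fun i => continuous_violation p e A i
    fun_prop
  have hwB : w ∈ Metric.closedBall (0 : ι → ℝ) (M + 3) := by
    rw [mem_closedBall_zero_iff, pi_norm_le_iff_of_nonneg (by linarith)]
    intro j
    have := Finset.single_le_sum (f := fun j => (|w j| + 1) ^ 2) (fun _ _ => sq_nonneg _)
      (Finset.mem_univ j)
    rw [Real.norm_eq_abs]
    nlinarith [abs_nonneg (w j)]
  obtain ⟨x, hx, hmin⟩ := (isCompact_closedBall (0 : ι → ℝ) (M + 3)).exists_isMinOn ⟨w, hwB⟩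
    hcont.continuousOn
  have hHx : H x ≤ M := by
    refine (hmin hwB).trans (le_trans ?_ hM)
    simp only [hH, hw]
    have : ∀ j, (w j - b j) ^ 2 ≤ (|w j| + 1) ^ 2 := fun j => by
      rw [← sq_abs (w j - b j)]
      have := (abs_sub (w j) (b j)).trans (add_le_add_right (hb j) _)
      gcongr
    simpa using Finset.sum_le_sum fun j (_ : j ∈ Finset.univ) => this j
  have hpen : 0 ≤ K * ∑ i, violation p e A x i ^ 2 :=
    mul_nonneg hK (Finset.sum_nonneg fun _ _ => sq_nonneg _)
  have hdist : 0 ≤ ∑ j, (x j - b j) ^ 2 := Finset.sum_nonneg fun _ _ => sq_nonneg _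
  refine ⟨x, hx, ?_, fun i => ?_⟩
  · have hxint : x ∈ Metric.ball (0 : ι → ℝ) (M + 3) := by
      rw [mem_ball_zero_iff, pi_norm_lt_iff (by linarith)]
      intro j
      have h1 := Finset.single_le_sum (f := fun j => (x j - b j) ^ 2) (fun _ _ => sq_nonneg _)
        (Finset.mem_univ j)
      have h2 : (x j - b j) ^ 2 ≤ M := by simp only [hH] at hHx; linarith
      have h3 : |x j - b j| ≤ M + 1 := abs_le_of_sq_le_sq (by nlinarith) (by linarith)
      have h4 := abs_add_le (x j - b j) (b j)
      rw [sub_add_cancel] at h4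
      rw [Real.norm_eq_abs]
      linarith [hb j]
    exact hmin.isLocalMin (Filter.mem_of_superset (Metric.isOpen_ball.mem_nhds hxint)
      Metric.ball_subset_closedBall)
  · have h1 := Finset.single_le_sum (f := fun i => violation p e A x i ^ 2)
      (fun _ _ => sq_nonneg _) (Finset.mem_univ i)
    have h2 := mul_le_mul_of_nonneg_left h1 hK
    simp only [hH] at hHx h2
    linarith

theorem mem_iff_looseSet {ι κ : Type*} [Fintype κ] {p : κ → MvPolynomial ι ℝ} {e : κ → ℝ}
    {x : ι → ℝ} (hne : ∀ i, eval x (p i) ≠ e i) (A : Finset κ) (i : κ) :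
    i ∈ A ↔ (i ∈ looseSet p e A x ↔ eval x (p i) < e i) := by
  have := hne i
  simp only [looseSet, Finset.mem_filter, Finset.mem_univ, true_and]
  split_ifs with h
  · simp only [h, true_iff]
    exact ⟨fun h => lt_of_le_of_ne h this, le_of_lt⟩
  · simp only [h, false_iff]
    intro hiff
    rcases lt_or_gt_of_ne this with h1 | h1
    · exact absurd (hiff.2 h1) (not_le.2 h1)
    · exact absurd (hiff.1 h1.le) (not_lt.2 h1.le)

theorem card_filter_card_le (κ : Type*) [Fintype κ] (n : ℕ) :
    (Finset.univ.filter fun S : Finset κ => S.card ≤ n).card =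
      ∑ k ∈ Finset.range (n + 1), (Fintype.card κ).choose k := by
  classical
  rw [Finset.card_eq_sum_card_fiberwise (f := Finset.card) (t := Finset.range (n + 1))
    (fun S hS => by simpa [Nat.lt_succ_iff] using hS)]
  refine Finset.sum_congr rfl fun k hk => ?_
  rw [← Finset.card_univ, ← Finset.card_powersetCard]
  congr 1
  ext S
  simp only [Finset.mem_filter, Finset.mem_univ, true_and, Finset.mem_powersetCard,
    Finset.subset_univ, Finset.mem_range] at hk ⊢
  omega

/-- **Warren-type bound.** The number of sign patterns `{i | 0 < p_i(x)}` of `m` real polynomials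
of degree at most `D` in `n` variables is at most `(2D - 1) ^ n * ∑_{k ≤ n} (m choose k)`. -/
theorem card_signPatterns_le {ι κ : Type*} [Fintype ι] [Fintype κ]
    (p : κ → MvPolynomial ι ℝ) {D : ℕ} (hD : 0 < D) (hp : ∀ i, (p i).totalDegree ≤ D)
    (P : Finset (Finset κ)) (hP : ∀ A ∈ P, ∃ x : ι → ℝ, ∀ i, i ∈ A ↔ 0 < eval x (p i)) :
    P.card ≤ (2 * D - 1) ^ Fintype.card ι *
      ∑ k ∈ Finset.range (Fintype.card ι + 1), (Fintype.card κ).choose k := by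
  classical
  set n := Fintype.card ι
  have hP' : ∀ A : P, ∃ x : ι → ℝ, ∀ i, i ∈ A.1 ↔ 0 < eval x (p i) := fun A => hP A.1 A.2
  choose w hw using hP'
  -- generic positive levels below all positive values at the witnesses
  obtain ⟨δ, hδ, hδ0⟩ : ∃ δ : ℝ, (∀ (A : P) (i : κ), i ∈ A.1 → δ < eval (w A) (p i)) ∧ 0 < δ := by
    have : ∀ᶠ δ in 𝓝[>] (0 : ℝ), ∀ (A : P) (i : κ), i ∈ A.1 → δ < eval (w A) (p i) := by
      simp only [eventually_all]
      exact fun A i hi => mem_nhdsWithin_of_mem_nhds (gt_mem_nhds ((hw A i).1 hi))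
    exact (this.and self_mem_nhdsWithin).exists
  obtain ⟨e, ⟨heT, hevol⟩, heI⟩ := (dense_generic_levels p).exists_mem_open
    (isOpen_set_pi Set.finite_univ fun _ _ => isOpen_Ioo (a := (0 : ℝ)) (b := δ))
    ⟨fun _ => δ / 2, fun i _ => ⟨by linarith, by linarith⟩⟩
  have he : ∀ i, 0 < e i ∧ e i < δ := fun i => heI i (Set.mem_univ i)
  set M := ∑ A : P, ∑ j, (|w A j| + 1) ^ 2 with hM
  have hMw : ∀ A, ∑ j, (|w A j| + 1) ^ 2 ≤ M := fun A =>
    Finset.single_le_sum (f := fun A => ∑ j, (|w A j| + 1) ^ 2)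
      (fun _ _ => Finset.sum_nonneg fun _ _ => sq_nonneg _) (Finset.mem_univ A)
  have hM0 : 0 ≤ M := Finset.sum_nonneg fun _ _ => Finset.sum_nonneg fun _ _ => sq_nonneg _
  obtain ⟨η, hη0, hη⟩ := exists_margin p e n heT (isCompact_closedBall (0 : ι → ℝ) (M + 3))
  set K := (M + 1) / η ^ 2 with hK
  have hK0 : 0 < K := by positivity
  obtain ⟨b, hb, hb1⟩ := (MeasureTheory.Measure.dense_of_ae
    (ae_generic_base p e K hevol)).exists_mem_open Metric.isOpen_ball
      ⟨(0 : ι → ℝ), Metric.mem_ball_self one_pos⟩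
  have hbj : ∀ j, |b j| ≤ 1 := fun j =>
    (norm_le_pi_norm b j).trans (mem_ball_zero_iff.1 hb1).le
  have hmain : ∀ A : P, ∃ x, (looseSet p e A.1 x).card ≤ n ∧
      evalMap (penaltyGrad p e K (looseSet p e A.1 x)) x = b := by
    intro A
    obtain ⟨x, hxB, hmin, hviol⟩ := exists_isLocalMin_penalty p e hK0.le A.1 b (w A) hbj
      (fun i => by
        refine violation_eq_zero ?_
        simp only [looseSet, Finset.mem_filter, Finset.mem_univ, true_and]
        split_ifs with h
        · exact not_le.2 ((he i).2.trans (hδ A i h))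
        · exact not_le.2 ((not_lt.1 fun h' => h ((hw A i).2 h')).trans_lt (he i).1)) (hMw A)
    refine ⟨x, hη x hxB _ fun i hi => ?_, evalMap_penaltyGrad_looseSet_eq p e hK0.le A.1 b x hmin⟩
    refine abs_le_of_sq_le_sq ?_ hη0.le
    have h1 := hviol i
    rw [violation_sq_eq hi, hK, div_mul_eq_mul_div, div_le_iff₀ (by positivity)] at h1
    nlinarith [sq_nonneg η]
  choose x hxn hxb using hmain
  rw [← Finset.card_attach, ← card_filter_card_le κ n]
  refine Finset.card_le_mul_card_image_of_maps_to (f := fun A => looseSet p e A.1 (x A))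
    (fun A _ => by simpa using hxn A) _ fun S _ => ?_
  set fiber := P.attach.filter fun A => looseSet p e A.1 (x A) = S
  have hinj : Set.InjOn x fiber := by
    intro A hA A' hA' hxx
    simp only [fiber, Finset.coe_filter, Set.mem_ofPred_eq] at hA hA'
    ext i
    have hne := (hb _ _ (hxb A)).2
    rw [mem_iff_looseSet hne A.1 i, mem_iff_looseSet (hb _ _ (hxb A')).2 A'.1 i, hA.2, hA'.2, hxx]
  rw [← Finset.card_image_of_injOn hinj]
  have hsub : evalMap (fun j => penaltyGrad p e K S j - C (b j)) =
      fun y => evalMap (penaltyGrad p e K S) y - b := by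
    funext y j
    simp [evalMap]
  have hfib : ∀ z ∈ fiber.image x, evalMap (penaltyGrad p e K S) z = b := by
    intro z hz
    obtain ⟨A, hA, rfl⟩ := Finset.mem_image.1 hz
    rw [← (Finset.mem_filter.1 hA).2]
    exact hxb A
  refine card_nondegenerate_zeros_le (fun j => penaltyGrad p e K S j - C (b j)) (by omega)
    (fun j => (totalDegree_sub _ _).trans (max_le (totalDegree_penaltyGrad_le hD hp e K S j)
      (by simp))) _ (fun z hz => ?_) fun z hz => ?_
  · rw [hsub]
    simp [hfib z hz]
  · rw [hsub, fderiv_sub_const]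
    exact (hb S z (hfib z hz)).1

/-- The index `(⟨a, w⟩ + 1) / 2` as a polynomial in the coordinates of `a`, which are the
variables `v i`. -/
noncomputable def indexPoly {σ : Type*} {d : ℕ} (v : Fin d → σ) (w : Fin d → ℝ) :
    MvPolynomial σ ℝ :=
  C (1 / 2) * (∑ i, X (v i) * C (w i) + 1)

theorem eval_indexPoly {σ : Type*} {d : ℕ} (v : Fin d → σ) (w : Fin d → ℝ) (x : σ → ℝ) :
    eval x (indexPoly v w) = ((∑ i, x (v i) * w i) + 1) / 2 := by
  simp [indexPoly]
  ring

theorem totalDegree_indexPoly_le {σ : Type*} {d : ℕ} (v : Fin d → σ) (w : Fin d → ℝ) :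
    (indexPoly v w).totalDegree ≤ 1 := by
  refine (totalDegree_mul _ _).trans ?_
  rw [totalDegree_C, zero_add]
  refine (totalDegree_add _ _).trans (max_le ?_ (by simp))
  refine totalDegree_finsetSum_le fun i _ => (totalDegree_mul _ _).trans ?_
  simp

theorem index_mem_Icc {d : ℕ} {a w : Fin d → ℝ} (ha : ∑ i, |a i| ≤ 1) (hw : w ∈ unitCube d) :
    ((∑ i, a i * w i) + 1) / 2 ∈ Set.Icc (0 : ℝ) 1 := by
  have h : |∑ i, a i * w i| ≤ 1 := by
    refine (Finset.abs_sum_le_sum_abs _ _).trans ((Finset.sum_le_sum fun i _ => ?_).trans ha)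
    rw [abs_mul, abs_of_nonneg (hw i).1]
    exact mul_le_of_le_one_right (abs_nonneg (a i)) (hw i).2
  rw [abs_le] at h
  constructor <;> linarith [h.1, h.2]

theorem exists_mem_regularCell {T : ℕ} (hT : 0 < T) {x : ℝ} (hx : x ∈ Set.Icc (0 : ℝ) 1) :
    ∃ k < T, x ∈ regularCell T k := by
  have hT' : (0 : ℝ) < T := Nat.cast_pos.2 hT
  have hle : x * T ≤ ⌈x * T⌉₊ := Nat.le_ceil _
  have hc : ⌈x * T⌉₊ ≤ T := Nat.ceil_le.2 (mul_le_of_le_one_left hT'.le hx.2)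
  rcases le_or_gt ⌈x * T⌉₊ 1 with h | h
  · refine ⟨0, hT, ?_⟩
    have : (⌈x * T⌉₊ : ℝ) ≤ 1 := by exact_mod_cast h
    simp only [regularCell, if_true]
    exact ⟨hx.1, (le_div_iff₀ hT').2 (by linarith)⟩
  · obtain ⟨k, hk⟩ : ∃ k, ⌈x * T⌉₊ = k + 1 := ⟨⌈x * T⌉₊ - 1, by omega⟩
    refine ⟨k, by omega, ?_⟩
    rw [regularCell, if_neg (by omega)]
    rw [hk] at hle
    refine ⟨(div_lt_iff₀ hT').2 (Nat.lt_ceil.1 (by omega)), (le_div_iff₀ hT').2 ?_⟩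
    exact_mod_cast hle

theorem mem_regularCell_of_forall_lt_iff {T k : ℕ} (hk : k < T) {x y : ℝ}
    (hx : x ∈ regularCell T k) (hy : y ∈ Set.Icc (0 : ℝ) 1)
    (hxy : ∀ h : Fin T, ((h : ℕ) : ℝ) / T < x ↔ ((h : ℕ) : ℝ) / T < y) :
    y ∈ regularCell T k := by
  have hT : (0 : ℝ) < T := Nat.cast_pos.2 (by omega)
  have hupper : x ≤ ((k : ℝ) + 1) / T → y ≤ ((k : ℝ) + 1) / T := by
    intro h
    rcases Nat.lt_or_ge (k + 1) T with h1 | h1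
    · have := hxy ⟨k + 1, h1⟩
      push_cast at this
      exact not_lt.1 fun h2 => absurd (this.2 h2) (not_lt.2 h)
    · refine hy.2.trans ((le_div_iff₀ hT).2 ?_)
      rw [one_mul]
      exact_mod_cast h1
  unfold regularCell at hx ⊢
  split_ifs at hx ⊢ with h0
  · subst h0
    simp only [Nat.cast_zero, zero_add] at hupper
    exact ⟨hy.1, hupper hx.2⟩
  · exact ⟨(hxy ⟨k, hk⟩).1 hx.1, hupper hx.2⟩

/-- The subgraph patterns cut out by piecewise polynomials of indices, when the cells containing
the indices are prescribed. -/
theorem card_patterns_of_cells_le {d l r : ℕ} {t : Fin l → ℕ} {κ : Type*} [Fintype κ]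
    (w : κ → Fin d → ℝ) (s : κ → ℝ) (h : κ → ∀ j, Fin (t j)) (P : Finset (Finset κ))
    (hP : ∀ A ∈ P, ∃ a : Fin l → Fin d → ℝ, ∃ f ∈ pwPolyRegular l r t,
      (∀ q j, ((∑ i, a j i * w q i) + 1) / 2 ∈ regularCell (t j) (h q j)) ∧
      ∀ q, q ∈ A ↔ s q < f fun j => ((∑ i, a j i * w q i) + 1) / 2) :
    P.card ≤ (2 * (l * r) + 1) ^ (l * d + (∏ j, t j) * (r + 1) ^ l) *
      ∑ k ∈ Finset.range (l * d + (∏ j, t j) * (r + 1) ^ l + 1), (Fintype.card κ).choose k := by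
  classical
  let ι := (Fin l × Fin d) ⊕ ((∀ j, Fin (t j)) × (Fin l → Fin (r + 1)))
  have hι : Fintype.card ι = l * d + (∏ j, t j) * (r + 1) ^ l := by simp [ι]
  let p : κ → MvPolynomial ι ℝ := fun q =>
    ∑ e, X (Sum.inr (h q, e)) * ∏ j, indexPoly (fun i => Sum.inl (j, i)) (w q) ^ (e j : ℕ) - C (s q)
  have hp : ∀ q, (p q).totalDegree ≤ l * r + 1 := by
    intro q
    refine (totalDegree_sub _ _).trans (max_le ?_ (by simp))
    refine totalDegree_finsetSum_le fun e _ => (totalDegree_mul _ _).trans ?_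
    rw [totalDegree_X, add_comm]
    refine Nat.add_le_add_right ((totalDegree_finsetProd _ _).trans ?_) 1
    calc ∑ j, (indexPoly (fun i => (Sum.inl (j, i) : ι)) (w q) ^ (e j : ℕ)).totalDegree
        ≤ ∑ _j : Fin l, r := Finset.sum_le_sum fun j _ => (totalDegree_pow _ _).trans
          ((Nat.mul_le_mul (Nat.lt_succ_iff.1 (e j).2) (totalDegree_indexPoly_le _ _)).trans
            (by simp))
      _ = l * r := by simp
  have key := card_signPatterns_le p (Nat.succ_pos (l * r)) hp P ?_
  · rw [hι] at key
    exact key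
  intro A hA
  obtain ⟨a, f, hf, hcell, hAf⟩ := hP A hA
  choose c hc using fun g : ∀ j, Fin (t j) => hf (fun j => g j) fun j => (g j).2
  refine ⟨Sum.elim (fun z => a z.1 z.2) fun z => c z.1 z.2, fun q => ?_⟩
  rw [hAf, hc (h q) _ (hcell q)]
  simp [p, eval_indexPoly]

theorem card_patterns_le {d l r : ℕ} {t : Fin l → ℕ} (ht : ∀ j, 0 < t j) {κ : Type*} [Fintype κ]
    (w : κ → Fin d → ℝ) (hw : ∀ q, w q ∈ unitCube d) (s : κ → ℝ) (P : Finset (Finset κ))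
    (hP : ∀ A ∈ P, ∃ a : Fin l → Fin d → ℝ, ∃ f ∈ pwPolyRegular l r t,
      (∀ j, ∑ i, |a j i| ≤ 1) ∧ ∀ q, q ∈ A ↔ s q < f fun j => ((∑ i, a j i * w q i) + 1) / 2) :
    P.card ≤ ((2 * (l * r) + 1) ^ (l * d + (∏ j, t j) * (r + 1) ^ l) *
      ∑ k ∈ Finset.range (l * d + (∏ j, t j) * (r + 1) ^ l + 1), (Fintype.card κ).choose k) *
      ∑ k ∈ Finset.range (l * d + 1), (Fintype.card κ * ∑ j, t j).choose k := by
  classical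
  have hP' : ∀ A : P, ∃ a : Fin l → Fin d → ℝ, ∃ f ∈ pwPolyRegular l r t,
      (∀ j, ∑ i, |a j i| ≤ 1) ∧
        ∀ q, q ∈ A.1 ↔ s q < f fun j => ((∑ i, a j i * w q i) + 1) / 2 := fun A => hP A.1 A.2
  choose a f hf ha hAf using hP'
  let g : P → κ → Fin l → ℝ := fun A q j => ((∑ i, a A j i * w q i) + 1) / 2
  have hg : ∀ A q j, g A q j ∈ Set.Icc (0 : ℝ) 1 := fun A q j => index_mem_Icc (ha A j) (hw q)
  let cellPattern : P → Finset (κ × Σ j, Fin (t j)) := fun A =>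
    Finset.univ.filter fun z => ((z.2.2 : ℕ) : ℝ) / t z.2.1 < g A z.1 z.2.1
  have hcard : (P.attach.image cellPattern).card ≤
      ∑ k ∈ Finset.range (l * d + 1), (Fintype.card κ * ∑ j, t j).choose k := by
    have key := card_signPatterns_le (ι := Fin l × Fin d)
      (fun z : κ × Σ j, Fin (t j) => indexPoly (fun i => (z.2.1, i)) (w z.1) -
        C (((z.2.2 : ℕ) : ℝ) / t z.2.1)) one_pos
      (fun z => (totalDegree_sub _ _).trans (max_le (totalDegree_indexPoly_le _ _) (by simp)))
      (P.attach.image cellPattern) ?_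
    · simpa using key
    intro B hB
    obtain ⟨A, -, rfl⟩ := Finset.mem_image.1 hB
    exact ⟨fun z => a A z.1 z.2, fun z => by simp [cellPattern, eval_indexPoly, g]⟩
  rw [← Finset.card_attach]
  refine (Finset.card_le_mul_card_image_of_maps_to (f := cellPattern)
    (fun A hA => Finset.mem_image_of_mem _ hA) _ fun B hB => ?_).trans
    (Nat.mul_le_mul_left _ hcard)
  obtain ⟨A₀, -, rfl⟩ := Finset.mem_image.1 hB
  choose h hh hcell using fun q j => exists_mem_regularCell (ht j) (hg A₀ q j)
  rw [← Finset.card_image_of_injective _ Subtype.val_injective]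
  refine card_patterns_of_cells_le w s (fun q j => ⟨h q j, hh q j⟩) _ fun A' hA' => ?_
  obtain ⟨A, hA, rfl⟩ := Finset.mem_image.1 hA'
  refine ⟨a A, f A, hf A, fun q j => ?_, hAf A⟩
  refine mem_regularCell_of_forall_lt_iff (hh q j) (hcell q j) (hg A q j) fun i => ?_
  have := congrArg (fun B => (q, (⟨j, i⟩ : Σ j, Fin (t j))) ∈ B) (Finset.mem_filter.1 hA).2
  simpa [cellPattern] using this.symm

theorem sum_choose_mul_pow_le (M q : ℕ) {x : ℝ} (hx0 : 0 < x) (hx1 : x ≤ 1) :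
    (∑ k ∈ Finset.range (q + 1), (M.choose k : ℝ)) * x ^ q ≤ Real.exp (x * M) := by
  calc (∑ k ∈ Finset.range (q + 1), (M.choose k : ℝ)) * x ^ q
      ≤ ∑ k ∈ Finset.range (q + 1), x ^ k * (M.choose k : ℝ) := by
        rw [Finset.sum_mul]
        refine Finset.sum_le_sum fun k hk => ?_
        rw [mul_comm]
        gcongr ?_ * _
        exact pow_le_pow_of_le_one hx0.le hx1 (Nat.lt_succ_iff.1 (Finset.mem_range.1 hk))
    _ ≤ ∑ k ∈ Finset.range (q + M + 1), x ^ k * (M.choose k : ℝ) :=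
        Finset.sum_le_sum_of_subset_of_nonneg (Finset.range_mono (by omega))
          fun _ _ _ => by positivity
    _ = ∑ k ∈ Finset.range (M + 1), x ^ k * (M.choose k : ℝ) := by
        refine (Finset.sum_subset (Finset.range_mono (by omega)) fun k _ hk => ?_).symm
        rw [Nat.choose_eq_zero_of_lt (by simpa [Nat.lt_succ_iff] using hk)]
        simp
    _ = (x + 1) ^ M := by rw [add_pow]; simp
    _ ≤ Real.exp x ^ M := by gcongr; exact Real.add_one_le_exp x
    _ = Real.exp (x * M) := by rw [← Real.exp_nat_mul, mul_comm]

/-- The product of the two counting bounds, optimised over the parameter of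
`sum_choose_mul_pow_le`. -/
theorem mul_sum_choose_le {q n T B m : ℕ} (hB : 0 < B) (hm : q + n ≤ m) (hn : 0 < n) :
    (B : ℝ) ^ n * (∑ k ∈ Finset.range (n + 1), (m.choose k : ℝ)) *
      ∑ k ∈ Finset.range (q + 1), ((m * T).choose k : ℝ) ≤
      (Real.exp 1 * (T + B) * (m / (q + n))) ^ (q + n) := by
  have hB' : (1 : ℝ) ≤ B := by exact_mod_cast hB
  have hm0 : (0 : ℝ) < m := by exact_mod_cast (by omega : 0 < m)
  have hn' : (0 : ℝ) < (q : ℝ) + n := by exact_mod_cast (by omega : 0 < q + n)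
  have hm' : (q : ℝ) + n ≤ m := by exact_mod_cast hm
  have hT : (0 : ℝ) ≤ T := by positivity
  set z : ℝ := (q + n) / (m * (T + B)) with hz
  have hz0 : 0 < z := by positivity
  have hzB : z * B ≤ 1 := by
    rw [hz, div_mul_eq_mul_div, div_le_one (by positivity)]
    nlinarith [mul_nonneg hm0.le hT]
  have hz1 : z ≤ 1 := (le_mul_of_one_le_right hz0.le hB').trans hzB
  have h1 := sum_choose_mul_pow_le (m * T) q hz0 hz1
  have h2 := sum_choose_mul_pow_le m n (by positivity) hzB
  have h3 := mul_le_mul h2 h1 (by positivity) (by positivity)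
  have hexp : z * B * m + z * ((m * T : ℕ) : ℝ) = ((q + n : ℕ) : ℝ) * 1 := by
    push_cast
    rw [hz]
    field_simp
    ring
  rw [← Real.exp_add, hexp, Real.exp_nat_mul] at h3
  have hrhs : Real.exp 1 * (T + B) * (m / (q + n)) = Real.exp 1 / z := by
    rw [hz]
    field_simp
  rw [hrhs, div_pow, le_div_iff₀ (by positivity)]
  refine le_trans (le_of_eq ?_) h3
  rw [mul_pow, pow_add]
  ring

/-- The solution of `2 ^ x ≤ 2 e U x` is at most `log₂ (4 e U log₂ (2 e U))`. -/
theorem lt_rpow_of_logb_lt {U x : ℝ} (hU : 3 ≤ U)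
    (hx : Real.logb 2 (4 * Real.exp 1 * U * Real.logb 2 (2 * Real.exp 1 * U)) < x) :
    2 * Real.exp 1 * U * x < 2 ^ x := by
  set y := Real.logb 2 (2 * Real.exp 1 * U) with hy
  have he : 2 < Real.exp 1 := by linarith [Real.exp_one_gt_d9]
  have hV : 0 < 2 * Real.exp 1 * U := by positivity
  have hy2 : (2 : ℝ) ^ y = 2 * Real.exp 1 * U := Real.rpow_logb (by norm_num) (by norm_num) hV
  have hy3 : 3 ≤ y := by
    rw [hy, Real.le_logb_iff_rpow_le (by norm_num) hV]
    norm_num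
    nlinarith
  have hlog2 : 0.6931471803 < Real.log 2 := Real.log_two_gt_d9
  have hL : Real.logb 2 (4 * Real.exp 1 * U * y) = y + Real.logb 2 (2 * y) := by
    rw [show 4 * Real.exp 1 * U * y = 2 * Real.exp 1 * U * (2 * y) by ring,
      Real.logb_mul hV.ne' (by positivity)]
  rw [hL] at hx
  have hx0 : 0 < x := by
    have : 0 < Real.logb 2 (2 * y) := Real.logb_pos (by norm_num) (by linarith)
    linarith
  have hmain : y + Real.logb 2 x < x := by
    rcases le_or_gt x (2 * y) with h | h
    · have := Real.logb_le_logb_of_le (b := 2) (by norm_num) hx0 h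
      linarith
    · have hlog : Real.log (x / 4) ≤ x / 4 - 1 := Real.log_le_sub_one_of_pos (by positivity)
      rw [Real.log_div hx0.ne' (by norm_num), show (4 : ℝ) = 2 ^ 2 by norm_num, Real.log_pow]
        at hlog
      have hlogb : Real.logb 2 x ≤ x / 2 := by
        rw [Real.logb, div_le_iff₀ (by linarith)]
        push_cast at hlog
        nlinarith
      linarith
  have h2 : (2 : ℝ) ^ Real.logb 2 x = x := Real.rpow_logb (by norm_num) (by norm_num) hx0
  calc 2 * Real.exp 1 * U * x = 2 ^ y * 2 ^ Real.logb 2 x := by rw [hy2, h2]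
    _ = 2 ^ (y + Real.logb 2 x) := (Real.rpow_add (by norm_num) _ _).symm
    _ < 2 ^ x := Real.rpow_lt_rpow_of_exponent_lt (by norm_num) hmain

theorem two_pow_card_le_of_shatters {d l r : ℕ} {t : Fin l → ℕ} (ht : ∀ j, 0 < t j) {vm vp : ℝ}
    (S : Finset ((Fin d → ℝ) × ℝ)) (hS : ∀ q ∈ S, q.1 ∈ unitCube d)
    (hshat : ∀ S' ⊆ S, ∃ f ∈ multipleIndexClass d l r t vm vp,
      (↑S' : Set ((Fin d → ℝ) × ℝ)) = ↑S ∩ {q | q.2 < f q.1}) :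
    2 ^ S.card ≤ ((2 * (l * r) + 1) ^ (l * d + (∏ j, t j) * (r + 1) ^ l) *
      ∑ k ∈ Finset.range (l * d + (∏ j, t j) * (r + 1) ^ l + 1), S.card.choose k) *
      ∑ k ∈ Finset.range (l * d + 1), (S.card * ∑ j, t j).choose k := by
  classical
  have hmem : ∀ S' ⊆ S, ∃ f ∈ multipleIndexClass d l r t vm vp,
      ∀ q ∈ S, q ∈ S' ↔ q.2 < f q.1 := by
    intro S' hS'
    obtain ⟨f, hf, h⟩ := hshat S' hS'
    refine ⟨f, hf, fun q hq => ?_⟩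
    have := congrArg (fun B => q ∈ B) h
    simpa [hq] using this
  have hlow : ∀ q ∈ S, vm ≤ q.2 ∨ vp ≤ q.2 := by
    intro q hq
    obtain ⟨f, ⟨a, -, ft, -, rfl⟩, h⟩ := hmem ∅ (Finset.empty_subset _)
    have := (h q hq).not.1 (Finset.notMem_empty q)
    rw [lt_min_iff, lt_max_iff] at this
    by_contra! hlt
    exact this ⟨Or.inr hlt.1, hlt.2⟩
  have hup : ∀ q ∈ S, q.2 < vp := by
    intro q hq
    obtain ⟨f, ⟨a, -, ft, -, rfl⟩, h⟩ := hmem S subset_rfl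
    exact (lt_min_iff.1 ((h q hq).1 hq)).2
  have key := card_patterns_le (r := r) ht (fun q : S => q.1.1) (fun q => hS q.1 q.2)
    (fun q => q.1.2) Finset.univ fun A _ => ?_
  · simpa using key
  obtain ⟨f, ⟨a, ha, ft, hft, rfl⟩, h⟩ := hmem (A.map (Function.Embedding.subtype _)) fun q hq => by
    obtain ⟨x, -, rfl⟩ := Finset.mem_map.1 hq
    exact x.2
  refine ⟨a, ft, hft, ha, fun q => ?_⟩
  have hq := h q.1 q.2
  have hvm := (hlow q.1 q.2).resolve_right (not_le.2 (hup q.1 q.2))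
  rw [lt_min_iff, lt_max_iff, or_iff_left (not_lt.2 hvm), and_iff_left (hup q.1 q.2)] at hq
  rw [← hq]
  simp

end

/-- **VC dimension of multiple index classes (Proposition 2, Section 5).**
With `U = ∑_j t_j + lr + l + 1`, the class `Γ̄^M_{(t,r)}` is VC-subgraph on `[0,1]^d` with
dimension at most `2 + [2ld + (∏_j t_j)(r+1)^l] log₂(4eU log₂(2eU))`. -/
theorem multiple_index_class_vc_dimension
    (d l : ℕ) (hd : 0 < d) (hl : 0 < l) (r : ℕ) (t : Fin l → ℕ) (ht : ∀ j, 0 < t j)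
    (vm vp : ℝ) (hv : vm < vp) :
    VCSubgraphLEOn (unitCube d) (multipleIndexClass d l r t vm vp)
      (2 + (2 * (l : ℝ) * (d : ℝ) + (∏ j, (t j : ℝ)) * ((r : ℝ) + 1) ^ l) *
        Real.logb 2 (4 * Real.exp 1 * ((∑ j, (t j : ℝ)) + (l : ℝ) * (r : ℝ) + (l : ℝ) + 1) *
          Real.logb 2 (2 * Real.exp 1 *
            ((∑ j, (t j : ℝ)) + (l : ℝ) * (r : ℝ) + (l : ℝ) + 1)))) := by
  intro S hS hcard
  by_contra! hshat
  have hcount := two_pow_card_le_of_shatters ht S hS hshat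
  have hU1 : (1 : ℝ) ≤ ∑ j, (t j : ℝ) := by
    have h1 : t ⟨0, hl⟩ ≤ ∑ j, t j :=
      Finset.single_le_sum (f := t) (fun _ _ => Nat.zero_le _) (Finset.mem_univ _)
    exact_mod_cast (ht ⟨0, hl⟩).trans_le h1
  have hl1 : (1 : ℝ) ≤ l := by exact_mod_cast hl
  have hd1 : (1 : ℝ) ≤ d := by exact_mod_cast hd
  have hlr : (0 : ℝ) ≤ (l : ℝ) * r := by positivity
  set U : ℝ := (∑ j, (t j : ℝ)) + (l : ℝ) * (r : ℝ) + (l : ℝ) + 1 with hU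
  have hU3 : 3 ≤ U := by linarith
  set m := S.card
  set p : ℕ := (∏ j, t j) * (r + 1) ^ l with hp
  have hp' : (∏ j, (t j : ℝ)) * ((r : ℝ) + 1) ^ l = p := by
    rw [hp]
    push_cast
    rfl
  rw [hp', gt_iff_lt] at hcard
  set N : ℝ := 2 * (l : ℝ) * (d : ℝ) + p with hN
  have hN0 : 0 < N := by positivity
  set L := Real.logb 2 (4 * Real.exp 1 * U * Real.logb 2 (2 * Real.exp 1 * U)) with hL
  have hL' : L < m / N := by
    rw [lt_div_iff₀ hN0]
    linarith
  have hgrowth := lt_rpow_of_logb_lt hU3 hL'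
  have hm : l * d + (l * d + p) ≤ m := by
    have he : 1 < Real.exp 1 := Real.one_lt_exp_iff.2 one_pos
    have h1 : 1 ≤ Real.logb 2 (2 * Real.exp 1 * U) := by
      rw [Real.le_logb_iff_rpow_le (by norm_num) (by positivity), Real.rpow_one]
      nlinarith
    have h2 : 1 ≤ L := by
      rw [hL, Real.le_logb_iff_rpow_le (by norm_num) (by positivity), Real.rpow_one]
      nlinarith [mul_le_mul he.le h1 zero_le_one (by positivity)]
    have h3 : ((l * d + (l * d + p) : ℕ) : ℝ) ≤ m := by
      push_cast
      nlinarith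
    exact_mod_cast h3
  have hbound := mul_sum_choose_le (q := l * d) (n := l * d + p) (T := ∑ j, t j)
    (B := 2 * (l * r) + 1) (Nat.succ_pos _) hm (by positivity)
  have hcount' : (2 : ℝ) ^ m ≤ _ := le_trans (by exact_mod_cast hcount) hbound
  have hNcast : ((l * d : ℕ) : ℝ) + ((l * d + p : ℕ) : ℝ) = N := by
    push_cast
    ring
  rw [hNcast, ← Real.rpow_natCast _ (l * d + (l * d + p))] at hcount'
  push_cast at hcount'
  have hexponent : (l : ℝ) * d + (l * d + p) = N := by ring
  rw [hexponent] at hcount'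
  have hle : Real.exp 1 * ((∑ j, (t j : ℝ)) + (2 * (l * r) + 1)) * (m / N) ≤
      2 * Real.exp 1 * U * (m / N) := by
    rw [mul_comm 2 (Real.exp 1), mul_assoc (Real.exp 1) 2 U]
    gcongr
    linarith
  have hlt := Real.rpow_lt_rpow (by positivity) (hle.trans_lt hgrowth) hN0
  rw [← Real.rpow_mul (by norm_num), div_mul_cancel₀ _ hN0.ne', Real.rpow_natCast] at hlt
  exact absurd hcount' (not_le.2 hlt)
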